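/- Let R = ∏_{n∈ℕ} ℤ/2ℤ with componentwise operations and let 𝔞 = ⊕_{n∈ℕ} ℤ/2ℤ be the two-sided idempotent ideal of finitely supported elements. Then there is no torsion pair (𝒳,𝒴) in fp(R-Mod) such that lim→𝒳 = C_𝔞 and lim→𝒴 = T_𝔞. Hence for this left coherent ring the assignment (𝒳,𝒴) ↦ (lim→𝒳, lim→𝒴) from torsion pairs in fp(R-Mod) to tCG torsion pairs in R-Mod is not surjective. -/

import Mathlib

open CategoryTheory Limits DirectSum

universe w u

variable (R : Type u) [Ring R]

/-- The ring `∏_{n ∈ ℕ} ℤ/2ℤ` with componentwise addition and multiplication. -/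
abbrev RProd : Type := ℕ → ZMod 2

/-- The two-sided idempotent ideal `⊕_{n ∈ ℕ} ℤ/2ℤ` of finitely supported elements. -/
def frakA : Submodule RProd RProd where
  carrier := {x | (Function.support x).Finite}
  add_mem' := fun hx hy => ((hx.union hy)).subset (Function.support_add _ _)
  zero_mem' := by simp
  smul_mem' := by
    intro c x hx
    apply hx.subset
    intro n hn
    simp only [Function.mem_support] at hn ⊢
    intro h
    exact hn (by rw [smul_eq_mul, Pi.mul_apply, h, mul_zero])

/-- The submodule `𝔞M` of `M`, for a left ideal `𝔞` of `R`. -/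
def idealSMul (a : Submodule R R) (M : ModuleCat.{u} R) : Submodule R M :=
  Submodule.span R {x : M | ∃ r ∈ a, ∃ m : M, x = r • m}

/-- `a` is a two-sided idempotent ideal of `R`: a left ideal closed under right
multiplication which satisfies `a * a = a`. -/
structure IsIdempotentTwoSidedIdeal (a : Submodule R R) : Prop where
  mul_mem_right : ∀ x ∈ a, ∀ r : R, x * r ∈ a
  idem : Submodule.span R {x : R | ∃ b ∈ a, ∃ c ∈ a, x = b * c} = a

/-- The class `C_𝔞 = {M : 𝔞M = M}`. -/
def CClass (a : Submodule R R) : ModuleCat.{u} R → Prop :=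
  fun M => idealSMul R a M = ⊤

/-- The class `T_𝔞 = {M : 𝔞M = 0}`. -/
def TClass (a : Submodule R R) : ModuleCat.{u} R → Prop :=
  fun M => ∀ r ∈ a, ∀ m : M, r • m = (0 : M)

/-- A torsion pair `(X, Y)` in the category `fp(R-Mod)` of finitely presented left
`R`-modules. -/
structure FpTorsionPair (X Y : ModuleCat.{u} R → Prop) : Prop where
  fp_left : ∀ M, X M → Module.FinitePresentation R M
  fp_right : ∀ M, Y M → Module.FinitePresentation R M
  iso_closed_left : ∀ {M N : ModuleCat.{u} R}, (M ≅ N) → X M → X N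
  iso_closed_right : ∀ {M N : ModuleCat.{u} R}, (M ≅ N) → Y M → Y N
  hom_eq_zero : ∀ {M N : ModuleCat.{u} R}, X M → Y N → ∀ f : M →ₗ[R] N, f = 0
  exists_torsion_submodule : ∀ M : ModuleCat.{u} R, Module.FinitePresentation R M →
    ∃ t : Submodule R M, X (ModuleCat.of R t) ∧ Y (ModuleCat.of R (M ⧸ t))

/-- A presentation of `M` as a direct limit (filtered colimit) of modules in the class `X`. -/
structure DirectLimitPresentation (X : ModuleCat.{u} R → Prop) (M : ModuleCat.{u} R) where
  J : Type u
  [instCat : SmallCategory J]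
  [instFil : IsFiltered J]
  D : J ⥤ ModuleCat.{u} R
  c : Cocone D
  isColimit : IsColimit c
  mem : ∀ j, X (D.obj j)
  iso : c.pt ≅ M

/-- `lim→ X`: the class of modules isomorphic to a direct limit of modules in `X`. -/
def LimClass (X : ModuleCat.{u} R → Prop) (M : ModuleCat.{u} R) : Prop :=
  Nonempty (DirectLimitPresentation R X M)

/-- Every class of modules is contained in its closure under direct limits. -/
theorem limClass_of_mem {R : Type u} [Ring R] {X : ModuleCat.{u} R → Prop} {M : ModuleCat.{u} R}
    (hM : X M) : LimClass R X M :=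
  ⟨{  J := PUnit.{u + 1}
      instCat := Preorder.smallCategory _
      instFil := inferInstance
      D := (Functor.const _).obj M
      c := constCocone _ M
      isColimit := isColimitConstCocone _ M
      mem := fun _ => hM
      iso := Iso.refl _ }⟩

/-- A submodule `t` of `R` with `𝔞t = t` is contained in the right-stable left ideal `𝔞`. -/
theorem le_of_cClass {R : Type u} [Ring R] {a t : Submodule R R}
    (ha : ∀ x ∈ a, ∀ r : R, x * r ∈ a) (ht : CClass R a (ModuleCat.of R t)) : t ≤ a := by
  have h : idealSMul R a (ModuleCat.of R t) ≤ a.comap t.subtype := by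
    refine Submodule.span_le.2 ?_
    rintro _ ⟨r, hr, m, rfl⟩
    exact ha r hr (m : t).1
  intro x hx
  have hx' : (⟨x, hx⟩ : t) ∈ idealSMul R a (ModuleCat.of R t) := by
    rw [show idealSMul R a (ModuleCat.of R t) = ⊤ from ht]
    trivial
  exact h hx'

/-- If `𝔞` annihilates `R/t`, then `𝔞` is contained in `t`. -/
theorem le_of_tClass_quotient {R : Type u} [Ring R] {a t : Submodule R R}
    (ht : TClass R a (ModuleCat.of R (R ⧸ t))) : a ≤ t := by
  intro r hr
  have h : r • (t.mkQ 1) = 0 := ht r hr (t.mkQ 1)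
  rw [← map_smul, smul_eq_mul, mul_one] at h
  exact (Submodule.Quotient.mk_eq_zero t).1 h

/-- The ideal of finitely supported elements of `∏_ℕ ℤ/2ℤ` is not finitely generated. -/
theorem not_fg_frakA : ¬ frakA.FG := by
  rintro ⟨s, hs⟩
  have hfin : (⋃ x ∈ s, Function.support x).Finite := by
    refine s.finite_toSet.biUnion fun x hx => ?_
    have : x ∈ frakA := hs ▸ Submodule.subset_span hx
    exact this
  obtain ⟨n, hn⟩ := hfin.exists_notMem
  have hle : frakA ≤ LinearMap.ker (LinearMap.mulLeft RProd (Pi.single n 1 : RProd)) := by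
    rw [← hs, Submodule.span_le]
    intro x hx
    have hxn : x n = 0 := by
      by_contra h
      exact hn (Set.mem_biUnion hx h)
    rw [SetLike.mem_coe, LinearMap.mem_ker, LinearMap.mulLeft_apply]
    ext m
    by_cases hm : m = n
    · subst hm; simp [hxn]
    · simp [hm]
  have hmem : (Pi.single n 1 : RProd) ∈ frakA :=
    (Set.finite_singleton n).subset Pi.support_single_subset
  have h0 := congrFun (LinearMap.mem_ker.1 (hle hmem)) n
  simp at h0

/-- **Theorem (non-surjectivity).** For the coherent ring `R = ∏_ℕ ℤ/2ℤ` and the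
idempotent ideal `𝔞 = ⊕_ℕ ℤ/2ℤ`, there is no torsion pair `(X, Y)` in `fp(R-Mod)` with
`lim→ X = C_𝔞` and `lim→ Y = T_𝔞`; hence `(X, Y) ↦ (lim→ X, lim→ Y)` is not surjective
onto tCG torsion pairs. -/
theorem prod_zmod2_not_in_image :
    ¬ ∃ X Y : ModuleCat.{0} RProd → Prop, FpTorsionPair RProd X Y ∧
      (∀ M : ModuleCat.{0} RProd, LimClass RProd X M ↔ CClass RProd frakA M) ∧
      (∀ M : ModuleCat.{0} RProd, LimClass RProd Y M ↔ TClass RProd frakA M) := by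
  rintro ⟨X, Y, hXY, hX, hY⟩
  obtain ⟨t, htX, htY⟩ := hXY.exists_torsion_submodule (ModuleCat.of RProd RProd)
    (inferInstanceAs (Module.FinitePresentation RProd RProd))
  have hle : t ≤ frakA := le_of_cClass
    (fun x hx r => by rw [mul_comm]; exact frakA.smul_mem r hx)
    ((hX _).1 (limClass_of_mem htX))
  have hge : frakA ≤ t := le_of_tClass_quotient ((hY _).1 (limClass_of_mem htY))
  have hfp : Module.FinitePresentation RProd t := hXY.fp_left _ htX
  have hfg : Submodule.FG (R := RProd) (M := RProd) t :=
    Module.Finite.iff_fg.1 (inferInstanceAs (Module.Finite RProd t))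
  exact not_fg_frakA (le_antisymm hle hge ▸ hfg)
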